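/- (Block-coordinate optimality at a Proximus fixed point.) Let X ∈ {0,1}^{m×n} and let (u,v) ∈ {0,1}^m × {0,1}^n satisfy u_i = 1((X_{i:})·v > h(v)/2) for all i and v_j = 1((X_{:j})·u > h(u)/2) for all j. Then h(X ⊕ uv^T) ≤ h(X ⊕ u'v^T) for every u' ∈ {0,1}^m, and h(X ⊕ uv^T) ≤ h(X ⊕ u(v')^T) for every v' ∈ {0,1}^n. -/

import Mathlib

open Finset

/-- Hamming weight of a binary vector. -/
def hW {m : ℕ} (x : Fin m → Bool) : ℕ :=
  (univ.filter fun i => x i = true).card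

/-- Hamming weight of a binary matrix. -/
def hM {m n : ℕ} (X : Fin m → Fin n → Bool) : ℕ :=
  (univ.filter fun p : Fin m × Fin n => X p.1 p.2 = true).card

/-- Integer inner product of two binary vectors. -/
def dotB {m : ℕ} (x y : Fin m → Bool) : ℕ :=
  (univ.filter fun i => (x i && y i) = true).card

/-- Cost h(X ⊕ u vᵀ) of the rank-one XOR approximation. -/
def cost {m n : ℕ} (X : Fin m → Fin n → Bool) (u : Fin m → Bool) (v : Fin n → Bool) : ℕ :=
  hM (fun i j => xor (X i j) (u i && v j))

theorem cost_eq_sum_hW {m n : ℕ} (X : Fin m → Fin n → Bool) (u : Fin m → Bool)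
    (v : Fin n → Bool) : cost X u v = ∑ i, hW (fun j => xor (X i j) (u i && v j)) := by
  simp only [cost, hM, hW, card_filter, Fintype.sum_prod_type]

theorem cost_transpose {m n : ℕ} (X : Fin m → Fin n → Bool) (u : Fin m → Bool)
    (v : Fin n → Bool) : cost (fun j i => X i j) v u = cost X u v := by
  simp only [cost, hM, card_filter, Fintype.sum_prod_type, Bool.and_comm]
  exact sum_comm

theorem hW_xor_add_two_mul_dotB {n : ℕ} (x v : Fin n → Bool) :
    hW (fun j => xor (x j) (v j)) + 2 * dotB x v = hW x + hW v := by
  simp only [hW, dotB, card_filter, mul_sum, ← sum_add_distrib]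
  refine sum_congr rfl fun j _ => ?_
  cases x j <;> cases v j <;> rfl

/-- Thresholding the inner product at half the weight of `v` is the optimal choice for a row. -/
theorem hW_xor_threshold_le {n : ℕ} (x v : Fin n → Bool) (b : Bool) :
    hW (fun j => xor (x j) (decide ((dotB x v : ℚ) > (hW v : ℚ) / 2) && v j)) ≤
      hW (fun j => xor (x j) (b && v j)) := by
  have h := hW_xor_add_two_mul_dotB x v
  have hx : hW (fun j => x j) = hW x := rfl
  by_cases hd : (dotB x v : ℚ) > (hW v : ℚ) / 2
  · have hlt : hW v < 2 * dotB x v := by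
      have : (hW v : ℚ) < 2 * dotB x v := by linarith
      exact_mod_cast this
    cases b <;> simp only [hd, decide_true, Bool.true_and, Bool.false_and, Bool.xor_false] <;>
      omega
  · have hle : 2 * dotB x v ≤ hW v := by
      have : 2 * (dotB x v : ℚ) ≤ hW v := by linarith
      exact_mod_cast this
    cases b <;> simp only [hd, decide_false, Bool.true_and, Bool.false_and, Bool.xor_false] <;>
      omega

theorem cost_le_of_threshold {m n : ℕ} (X : Fin m → Fin n → Bool) (u : Fin m → Bool)
    (v : Fin n → Bool) (hu : ∀ i, u i = decide ((dotB (X i) v : ℚ) > (hW v : ℚ) / 2))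
    (u' : Fin m → Bool) : cost X u v ≤ cost X u' v := by
  rw [cost_eq_sum_hW, cost_eq_sum_hW]
  refine sum_le_sum fun i _ => ?_
  rw [hu i]
  exact hW_xor_threshold_le (X i) v (u' i)

/-- block-coordinate optimality at a Proximus fixed point: the cost
cannot be decreased by changing the whole block u (with v fixed), nor by changing
the whole block v (with u fixed). -/
theorem proximus_fixed_point_block_opt {m n : ℕ}
    (X : Fin m → Fin n → Bool) (u : Fin m → Bool) (v : Fin n → Bool)
    (hu : ∀ i, u i = decide ((dotB (X i) v : ℚ) > (hW v : ℚ) / 2))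
    (hv : ∀ j, v j = decide ((dotB (fun i => X i j) u : ℚ) > (hW u : ℚ) / 2)) :
    (∀ u' : Fin m → Bool, cost X u v ≤ cost X u' v) ∧
    (∀ v' : Fin n → Bool, cost X u v ≤ cost X u v') := by
  refine ⟨cost_le_of_threshold X u v hu, fun v' => ?_⟩
  rw [← cost_transpose X u v, ← cost_transpose X u v']
  exact cost_le_of_threshold (fun j i => X i j) v u hv v'
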